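/- There exists a constant C > 0 such that for every rotor-router system on a finite connected non-bipartite graph with m edges and diameter D, carrying k ≥ 1 tokens, and every initial state S_0, there exists T ≤ C·(m⁴·D² + m·D·log(3km)) such that the state S_T is stable; in particular the stabilization time is O(m⁴D² + mD·log k). -/

import Mathlib

open Finset

namespace RotorRouter

variable {V : Type} [Fintype V] [DecidableEq V] (G : SimpleGraph V) [DecidableRel G.Adj]

/-- The outgoing arcs (darts) of a vertex `v`. -/
def outArcs (v : V) : Finset G.Dart := Finset.univ.filter (fun d => d.fst = v)

/-- The incoming arcs (darts) of a vertex `v`. -/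
def inArcs (v : V) : Finset G.Dart := Finset.univ.filter (fun d => d.snd = v)

/-- A state of the rotor-router system: at each vertex, the current pointer
(represented as an index, in the fixed cyclic order, of an outgoing arc) and the
number of tokens currently located at the vertex. -/
structure State where
  ptr : V → ℕ
  tokens : V → ℕ
  ptr_lt : ∀ v : V, 0 < G.degree v → ptr v < G.degree v

variable (ord : ∀ v : V, Fin (G.degree v) ≃ {d : G.Dart // d.fst = v})

/-- The number of tokens sent out on the `j`-th outgoing arc when `k` tokens leave a
vertex of degree `deg` in round-robin fashion, starting from pointer position `p`. -/
def sentCount (deg p k j : ℕ) : ℕ :=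
  ((Finset.range k).filter (fun i => (p + i) % deg = j)).card

/-- The number of tokens sent along the arc `d` during one step from state `S`. -/
def arcLoad (S : State G) (d : G.Dart) : ℕ :=
  sentCount (G.degree d.fst) (S.ptr d.fst) (S.tokens d.fst)
    (((ord d.fst).symm ⟨d, rfl⟩ : Fin (G.degree d.fst)) : ℕ)

/-- One synchronous step of the rotor-router system: every vertex sends out all of its
tokens in round-robin fashion, advancing its pointer after each token. -/
def step (S : State G) : State G where
  ptr v := if 0 < G.degree v then (S.ptr v + S.tokens v) % G.degree v else S.ptr v
  tokens v := (∑ d ∈ inArcs G v, arcLoad G ord S d) +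
    (if 0 < G.degree v then 0 else S.tokens v)
  ptr_lt v h := by simp only [if_pos h]; exact Nat.mod_lt _ h

/-- `evol S0 t` is the state `S_t` reached after `t` steps from the initial state `S0`. -/
def evol (S0 : State G) (t : ℕ) : State G := (step G ord)^[t] S0

/-- `load S0 t d` is `L_t(d)`, the number of tokens sent along arc `d` during step `t`. -/
def load (S0 : State G) (t : ℕ) (d : G.Dart) : ℕ := arcLoad G ord (evol G ord S0 t) d

/-- `cum S0 t1 t2 d` is the cumulative load `C_{t1}^{t2}(d) = Σ_{t1 ≤ t < t2} L_t(d)`. -/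
def cum (S0 : State G) (t1 t2 : ℕ) (d : G.Dart) : ℕ :=
  ∑ t ∈ Finset.Ico t1 t2, load G ord S0 t d

/-- `cumV S0 t1 t2 v` is the cumulative vertex load `C_{t1}^{t2}(v)`. -/
def cumV (S0 : State G) (t1 t2 : ℕ) (v : V) : ℕ :=
  ∑ t ∈ Finset.Ico t1 t2, (evol G ord S0 t).tokens v

/-- `pot S0 i t` is the `i`-th potential `Φ_i(S_t) = Σ_{e} (C_t^{t+i}(e))²`. -/
def pot (S0 : State G) (i t : ℕ) : ℕ := ∑ d : G.Dart, (cum G ord S0 t (t + i) d) ^ 2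

/-- A state `S_t` is stable if it repeats: `S_{t'} = S_t` for some `t' > t`. -/
def IsStable (S0 : State G) (t : ℕ) : Prop :=
  ∃ t' > t, evol G ord S0 t' = evol G ord S0 t

/-- A family of bijections `in(v) → out(v)` (encoded as a global bijection `M` on darts
with `(M d).fst = d.snd`) is valid w.r.t. the `Δt`-step subcycle decomposition of `S_T`
if `L_t(e) = L_{t+1}(M e)` for all arcs `e` and all `T ≤ t < T + Δt`. -/
def ValidMapping (S0 : State G) (T Δt : ℕ) (M : G.Dart → G.Dart) : Prop :=
  Function.Bijective M ∧ (∀ d : G.Dart, (M d).fst = d.snd) ∧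
    ∀ (d : G.Dart) (t : ℕ), T ≤ t → t < T + Δt →
      load G ord S0 t d = load G ord S0 (t + 1) (M d)

/-- `S_T` admits a `Δt`-step subcycle decomposition. -/
def HasSubcycleDecomp (S0 : State G) (T Δt : ℕ) : Prop :=
  ∃ M : G.Dart → G.Dart, ValidMapping G ord S0 T Δt M


/-- A rotor-router system: a finite connected undirected graph together with a fixed
cyclic ordering of the outgoing arcs at every vertex. -/
structure System where
  V : Type
  [fin : Fintype V]
  [deq : DecidableEq V]
  G : SimpleGraph V
  [adj : DecidableRel G.Adj]
  conn : G.Connected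
  ord : ∀ v : V, Fin (G.degree v) ≃ {d : G.Dart // d.fst = v}

attribute [instance] System.fin System.deq System.adj

theorem sq_sub_one_le_two_mul_sum_sq_sub {α : Type*} (s t : Finset α) (x y : α → ℤ)
    (hcard : s.card = t.card) (hsum : ∑ a ∈ s, x a = ∑ a ∈ t, y a)
    (hy : ∀ a ∈ t, ∀ b ∈ t, y a ≤ y b + 1) {a b : α} (ha : a ∈ s) (hb : b ∈ s) :
    (x a - x b) ^ 2 - 1 ≤ 2 * (∑ c ∈ s, x c ^ 2 - ∑ c ∈ t, y c ^ 2) := by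
  classical
  have hne : t.Nonempty := by
    rw [← Finset.card_pos, ← hcard]
    exact Finset.card_pos.2 ⟨a, ha⟩
  obtain ⟨r, hr, hmin⟩ := t.exists_min_image y hne
  set q := y r with hq
  have hexp : ∀ (u : Finset α) (z : α → ℤ), ∑ c ∈ u, (z c - q) * (z c - q - 1) =
      ∑ c ∈ u, z c ^ 2 - (2 * q + 1) * ∑ c ∈ u, z c + u.card * (q ^ 2 + q) := by
    intro u z
    rw [Finset.mul_sum, ← Finset.sum_sub_distrib, ← nsmul_eq_mul, ← Finset.sum_const,
      ← Finset.sum_add_distrib]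
    exact Finset.sum_congr rfl fun c _ => by ring
  have hzero : ∑ c ∈ t, (y c - q) * (y c - q - 1) = 0 := by
    refine Finset.sum_eq_zero fun c hc => ?_
    have h1 := hmin c hc
    have h2 := hy c hc r hr
    rcases (by omega : y c - q = 0 ∨ y c - q - 1 = 0) with h | h <;> simp [h]
  have hkey : ∑ c ∈ s, x c ^ 2 - ∑ c ∈ t, y c ^ 2 = ∑ c ∈ s, (x c - q) * (x c - q - 1) := by
    have h1 := hexp s x
    have h2 := hexp t y
    rw [hzero] at h2
    rw [hsum, hcard] at h1
    linarith
  have hnn : ∀ c ∈ s, 0 ≤ (x c - q) * (x c - q - 1) := by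
    intro c _
    rcases le_or_gt (x c - q) 0 with h | h
    · exact mul_nonneg_of_nonpos_of_nonpos h (by linarith)
    · exact mul_nonneg h.le (by omega)
  rw [hkey]
  by_cases hab : a = b
  · subst hab
    have := Finset.sum_nonneg hnn
    nlinarith
  · have hsub : ∑ c ∈ ({a, b} : Finset α), (x c - q) * (x c - q - 1) ≤
        ∑ c ∈ s, (x c - q) * (x c - q - 1) := by
      refine Finset.sum_le_sum_of_subset_of_nonneg ?_ fun c hc _ => hnn c hc
      intro c hc
      simp only [Finset.mem_insert, Finset.mem_singleton] at hc
      rcases hc with rfl | rfl <;> assumption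
    rw [Finset.sum_pair hab] at hsub
    nlinarith [sq_nonneg ((x a - q) + (x b - q) - 1)]

theorem sum_sq_le_sum_sq_of_balanced {α : Type*} (s t : Finset α) (x y : α → ℤ)
    (hcard : s.card = t.card) (hsum : ∑ a ∈ s, x a = ∑ a ∈ t, y a)
    (hy : ∀ a ∈ t, ∀ b ∈ t, y a ≤ y b + 1) :
    ∑ c ∈ t, y c ^ 2 ≤ ∑ c ∈ s, x c ^ 2 := by
  rcases s.eq_empty_or_nonempty with rfl | ⟨a, ha⟩
  · have : t = ∅ := by simpa using hcard.symm
    simp [this]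
  · have := sq_sub_one_le_two_mul_sum_sq_sub s t x y hcard hsum hy ha ha
    simp only [sub_self] at this
    omega

theorem eq_of_monotone_of_sum_eq {n : ℕ} {p q : Fin n → ℕ} (hp : Monotone p) (hq : Monotone q)
    (hp' : ∀ i j, p i ≤ p j + 1) (hq' : ∀ i j, q i ≤ q j + 1) (h : ∑ i, p i = ∑ i, q i) :
    p = q := by
  have key : ∀ {p q : Fin n → ℕ}, Monotone p → Monotone q → (∀ i j, p i ≤ p j + 1) →
      (∀ i j, q i ≤ q j + 1) → ∑ i, p i = ∑ i, q i → ∀ i, q i ≤ p i := by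
    intro p q hp hq hp' hq' h i
    by_contra! hlt
    refine h.not_lt (Finset.sum_lt_sum (fun j _ => ?_) ⟨i, Finset.mem_univ i, hlt⟩)
    rcases le_total i j with hij | hij
    · have := hq hij
      have := hp' j i
      omega
    · have := hp hij
      have := hq' i j
      omega
  exact funext fun i => le_antisymm (key hq hp hq' hp' h.symm i) (key hp hq hp' hq' h i)

theorem exists_equiv_fin_monotone {ι : Type*} [Fintype ι] (x : ι → ℕ → ℕ) (n : ℕ)
    (hx : ∀ i j a b, a ≤ b → b ≤ n → ∑ t ∈ Ico a b, x i t ≤ ∑ t ∈ Ico a b, x j t + 1) :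
    ∃ e : Fin (Fintype.card ι) ≃ ι, ∀ t ≤ n, Monotone fun i => ∑ u ∈ range t, x (e i) u := by
  classical
  set X : ι → ℕ → ℕ := fun i t => ∑ u ∈ range t, x i u with hX
  have hdiff : ∀ i j a b, a ≤ n → b ≤ n → X i a + X j b ≤ X j a + X i b + 1 := by
    intro i j a b ha hb
    rcases le_total a b with hab | hab
    · have h1 := hx j i a b hab hb
      have h2 := Finset.sum_range_add_sum_Ico (x i) hab
      have h3 := Finset.sum_range_add_sum_Ico (x j) hab
      simp only [hX]
      omega
    · have h1 := hx i j b a hab ha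
      have h2 := Finset.sum_range_add_sum_Ico (x i) hab
      have h3 := Finset.sum_range_add_sum_Ico (x j) hab
      simp only [hX]
      omega
  set e₀ := (Fintype.equivFin ι).symm
  set key : ι → ℕ := fun i => ∑ t ∈ range (n + 1), X i t with hkey
  set σ := Tuple.sort (key ∘ e₀)
  refine ⟨σ.trans e₀, fun t ht i j hij => ?_⟩
  have hm : key (e₀ (σ i)) ≤ key (e₀ (σ j)) := Tuple.monotone_sort (key ∘ e₀) hij
  change X (e₀ (σ i)) t ≤ X (e₀ (σ j)) t
  by_contra! hlt
  refine hm.not_gt (Finset.sum_lt_sum (fun u hu => ?_) ⟨t, by simp; omega, hlt⟩)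
  have := hdiff (e₀ (σ i)) (e₀ (σ j)) t u ht (by simp at hu; omega)
  omega

theorem exists_equiv_of_balanced {ι κ : Type*} [Fintype ι] [Fintype κ]
    (hcard : Fintype.card ι = Fintype.card κ) (x : ι → ℕ → ℕ) (y : κ → ℕ → ℕ) (n : ℕ)
    (hx : ∀ i j a b, a ≤ b → b ≤ n → ∑ t ∈ Ico a b, x i t ≤ ∑ t ∈ Ico a b, x j t + 1)
    (hy : ∀ i j a b, a ≤ b → b ≤ n → ∑ t ∈ Ico a b, y i t ≤ ∑ t ∈ Ico a b, y j t + 1)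
    (hsum : ∀ t < n, ∑ i, x i t = ∑ j, y j t) :
    ∃ σ : ι ≃ κ, ∀ i, ∀ t < n, x i t = y (σ i) t := by
  obtain ⟨e, he⟩ := exists_equiv_fin_monotone x n hx
  obtain ⟨f, hf⟩ := exists_equiv_fin_monotone y n hy
  set f' : Fin (Fintype.card ι) ≃ κ := (finCongr hcard).trans f with hf'
  have hfm : ∀ t ≤ n, Monotone fun i => ∑ u ∈ range t, y (f' i) u := by
    intro t ht i j hij
    exact hf t ht (show Fin.cast hcard i ≤ Fin.cast hcard j from hij)
  have heq : ∀ t ≤ n, ∀ i, ∑ u ∈ range t, x (e i) u = ∑ u ∈ range t, y (f' i) u := by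
    intro t ht i
    refine congrFun (eq_of_monotone_of_sum_eq (he t ht) (hfm t ht) ?_ ?_ ?_) i
    · intro i j
      simpa using hx (e i) (e j) 0 t (Nat.zero_le _) ht
    · intro i j
      simpa using hy (f' i) (f' j) 0 t (Nat.zero_le _) ht
    · rw [Finset.sum_comm, Finset.sum_comm (s := univ)]
      refine Finset.sum_congr rfl fun u hu => ?_
      rw [Equiv.sum_comp e (fun i => x i u), Equiv.sum_comp f' (fun i => y i u)]
      exact hsum u (by simp at hu; omega)
  refine ⟨e.symm.trans f', fun i t ht => ?_⟩
  have h1 := heq t ht.le (e.symm i)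
  have h2 := heq (t + 1) ht (e.symm i)
  rw [Finset.sum_range_succ, Finset.sum_range_succ, h1] at h2
  simpa using h2

theorem sentCount_add (deg p k l j : ℕ) :
    sentCount deg p (k + l) j = sentCount deg p k j + sentCount deg ((p + k) % deg) l j := by
  simp only [sentCount, Finset.card_filter, Finset.sum_range_add, Nat.mod_add_mod, add_assoc]

theorem sentCount_le_one {deg k : ℕ} (p j : ℕ) (hk : k ≤ deg) : sentCount deg p k j ≤ 1 := by
  refine Finset.card_le_one.2 fun a ha b hb => ?_
  simp only [Finset.mem_filter, Finset.mem_range] at ha hb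
  have h : a ≡ b [MOD deg] :=
    Nat.ModEq.add_left_cancel' p (show (p + a) % deg = (p + b) % deg by rw [ha.2, hb.2])
  exact h.eq_of_lt_of_lt (by omega) (by omega)

theorem sum_sentCount {deg : ℕ} (p k : ℕ) (hdeg : 0 < deg) :
    ∑ j : Fin deg, sentCount deg p k j = k := by
  rw [Fin.sum_univ_eq_sum_range (fun j => sentCount deg p k j)]
  have := Finset.card_eq_sum_card_fiberwise (s := range k) (t := range deg)
    (f := fun i => (p + i) % deg) (fun i _ => by simpa using Nat.mod_lt _ hdeg)
  simpa [sentCount] using this.symm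

theorem sentCount_self {deg : ℕ} (p : ℕ) (j : Fin deg) : sentCount deg p deg j = 1 := by
  have hsum := sum_sentCount p deg j.pos
  by_contra hne
  have hlt : ∑ i : Fin deg, sentCount deg p deg i < ∑ _i : Fin deg, 1 :=
    Finset.sum_lt_sum (fun i _ => sentCount_le_one p i le_rfl)
      ⟨j, Finset.mem_univ j, lt_of_le_of_ne (sentCount_le_one p j le_rfl) hne⟩
  simp [hsum] at hlt

theorem sentCount_le_succ {deg : ℕ} (p k : ℕ) (i j : Fin deg) :
    sentCount deg p k i ≤ sentCount deg p k j + 1 := by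
  induction k using Nat.strong_induction_on generalizing p with
  | _ k ih =>
    rcases lt_or_ge k deg with h | h
    · exact (sentCount_le_one p i h.le).trans (Nat.le_add_left _ _)
    · obtain ⟨l, rfl⟩ := Nat.exists_eq_add_of_le h
      have := i.pos
      have := ih l (by omega) ((p + deg) % deg)
      rw [sentCount_add, sentCount_add, sentCount_self, sentCount_self]
      omega

omit [DecidableEq V] in
theorem degree_fst_pos (d : G.Dart) : 0 < G.degree d.fst :=
  d.adj.degree_pos_left

omit [DecidableEq V] in
theorem degree_snd_pos (d : G.Dart) : 0 < G.degree d.snd :=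
  d.adj.degree_pos_right

theorem card_outArcs (v : V) : (outArcs G v).card = G.degree v :=
  G.dart_fst_fiber_card_eq_degree v

theorem card_inArcs (v : V) : (inArcs G v).card = (outArcs G v).card := by
  refine Finset.card_bij' (fun d _ => d.symm) (fun d _ => d.symm) ?_ ?_ ?_ ?_ <;>
    simp [inArcs, outArcs]

theorem sum_inArcs_eq_sum {M : Type*} [AddCommMonoid M] (g : G.Dart → M) :
    ∑ v, ∑ d ∈ inArcs G v, g d = ∑ d, g d :=
  Finset.sum_fiberwise univ (fun d : G.Dart => d.snd) g

theorem sum_outArcs_eq_sum {M : Type*} [AddCommMonoid M] (g : G.Dart → M) :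
    ∑ v, ∑ d ∈ outArcs G v, g d = ∑ d, g d :=
  Finset.sum_fiberwise univ (fun d : G.Dart => d.fst) g

theorem sum_outArcs_arcLoad (S : State G) {v : V} (hv : 0 < G.degree v) :
    ∑ d ∈ outArcs G v, arcLoad G ord S d = S.tokens v := by
  rw [← sum_sentCount (S.ptr v) (S.tokens v) hv, ← Equiv.sum_comp (ord v).symm]
  rw [outArcs, ← Finset.sum_subtype_eq_sum_filter, Finset.subtype_univ]
  refine Finset.sum_congr rfl fun d _ => ?_
  obtain ⟨d, rfl⟩ := d
  rfl

variable (S0 : State G)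

theorem evol_succ (t : ℕ) : evol G ord S0 (t + 1) = step G ord (evol G ord S0 t) :=
  Function.iterate_succ_apply' _ _ _

theorem sum_outArcs_load (t : ℕ) {v : V} (hv : 0 < G.degree v) :
    ∑ d ∈ outArcs G v, load G ord S0 t d = (evol G ord S0 t).tokens v :=
  sum_outArcs_arcLoad G ord _ hv

theorem sum_inArcs_load (t : ℕ) {v : V} (hv : 0 < G.degree v) :
    ∑ d ∈ inArcs G v, load G ord S0 t d = (evol G ord S0 (t + 1)).tokens v := by
  rw [evol_succ]
  simp [step, hv, load]

theorem sum_inArcs_load_eq_sum_outArcs_load (t : ℕ) (v : V) :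
    ∑ d ∈ inArcs G v, load G ord S0 t d = ∑ d ∈ outArcs G v, load G ord S0 (t + 1) d := by
  rcases (G.degree v).eq_zero_or_pos with hv | hv
  · have h1 := card_outArcs G v
    rw [hv] at h1
    have h2 := (card_inArcs G v).trans h1
    rw [Finset.card_eq_zero] at h1 h2
    simp [h1, h2]
  · rw [sum_inArcs_load G ord S0 t hv, sum_outArcs_load G ord S0 (t + 1) hv]

theorem ptr_evol {v : V} (hv : 0 < G.degree v) {a b : ℕ} (hab : a ≤ b) :
    (evol G ord S0 b).ptr v =
      ((evol G ord S0 a).ptr v + cumV G ord S0 a b v) % G.degree v := by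
  induction b, hab using Nat.le_induction with
  | base => simp [cumV, Nat.mod_eq_of_lt ((evol G ord S0 a).ptr_lt v hv)]
  | succ b hab ih =>
    rw [evol_succ]
    simp only [step, if_pos hv, cumV] at ih ⊢
    rw [ih, Finset.sum_Ico_succ_top hab, Nat.mod_add_mod, add_assoc]

theorem cum_eq_sentCount {a b : ℕ} (hab : a ≤ b) (d : G.Dart) :
    cum G ord S0 a b d =
      sentCount (G.degree d.fst) ((evol G ord S0 a).ptr d.fst) (cumV G ord S0 a b d.fst)
        ((ord d.fst).symm ⟨d, rfl⟩ : Fin (G.degree d.fst)) := by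
  induction b, hab using Nat.le_induction with
  | base => simp [cum, cumV, sentCount]
  | succ b hab ih =>
    have h1 : cum G ord S0 a (b + 1) d = cum G ord S0 a b d + load G ord S0 b d :=
      Finset.sum_Ico_succ_top hab _
    have h2 : cumV G ord S0 a (b + 1) d.fst =
        cumV G ord S0 a b d.fst + (evol G ord S0 b).tokens d.fst :=
      Finset.sum_Ico_succ_top hab _
    rw [h1, h2, sentCount_add, ih, load, arcLoad, ptr_evol G ord S0 (degree_fst_pos G d) hab]

theorem cum_le_cum_add_one_of_fst_eq {d d' : G.Dart} (h : d.fst = d'.fst) (a b : ℕ) :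
    cum G ord S0 a b d ≤ cum G ord S0 a b d' + 1 := by
  rcases le_total a b with hab | hab
  · have key : ∀ {v : V} (e e' : {d : G.Dart // d.fst = v}),
        cum G ord S0 a b e ≤ cum G ord S0 a b e' + 1 := by
      rintro v ⟨e, rfl⟩ ⟨e', he'⟩
      have h2 : cum G ord S0 a b e' =
          sentCount (G.degree e.fst) ((evol G ord S0 a).ptr e.fst) (cumV G ord S0 a b e.fst)
            ((ord e.fst).symm ⟨e', he'⟩ : Fin (G.degree e.fst)) := by
        rw [cum_eq_sentCount G ord S0 hab e']
        generalize hu : e.fst = u at he'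
        subst he'
        rfl
      rw [h2, cum_eq_sentCount G ord S0 hab e]
      exact sentCount_le_succ _ _ _ _
    exact key ⟨d, h⟩ ⟨d', rfl⟩
  · simp [cum, Finset.Ico_eq_empty_of_le hab]

theorem sum_inArcs_cum_eq_sum_outArcs_cum (a b : ℕ) (v : V) :
    ∑ d ∈ inArcs G v, cum G ord S0 a b d =
      ∑ d ∈ outArcs G v, cum G ord S0 (a + 1) (b + 1) d := by
  simp only [cum]
  rw [Finset.sum_comm, Finset.sum_comm (s := outArcs G v), ← Finset.sum_Ico_add']
  exact Finset.sum_congr rfl fun t _ => sum_inArcs_load_eq_sum_outArcs_load G ord S0 t v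

theorem sum_load (h : ∀ v, 0 < G.degree v) (t : ℕ) :
    ∑ d, load G ord S0 t d = ∑ v, S0.tokens v := by
  induction t with
  | zero =>
    rw [← sum_outArcs_eq_sum]
    exact Finset.sum_congr rfl fun v _ => sum_outArcs_load G ord S0 0 (h v)
  | succ t ih =>
    rw [← ih, ← sum_outArcs_eq_sum, ← sum_inArcs_eq_sum]
    exact Finset.sum_congr rfl fun v _ => (sum_inArcs_load_eq_sum_outArcs_load G ord S0 t v).symm

theorem sum_cum (h : ∀ v, 0 < G.degree v) (i t : ℕ) :
    ∑ d, cum G ord S0 t (t + i) d = i * ∑ v, S0.tokens v := by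
  simp only [cum]
  rw [Finset.sum_comm, Finset.sum_congr rfl fun s _ => sum_load G ord S0 h s]
  simp

theorem pot_sub_pot_eq (i t : ℕ) :
    (pot G ord S0 i t : ℤ) - pot G ord S0 i (t + 1) =
      ∑ v, (∑ d ∈ inArcs G v, (cum G ord S0 t (t + i) d : ℤ) ^ 2 -
        ∑ d ∈ outArcs G v, (cum G ord S0 (t + 1) (t + i + 1) d : ℤ) ^ 2) := by
  rw [Finset.sum_sub_distrib, sum_inArcs_eq_sum, sum_outArcs_eq_sum]
  simp [pot, add_right_comm]

theorem sum_outArcs_sq_le_sum_inArcs_sq (a b : ℕ) (v : V) :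
    ∑ d ∈ outArcs G v, (cum G ord S0 (a + 1) (b + 1) d : ℤ) ^ 2 ≤
      ∑ d ∈ inArcs G v, (cum G ord S0 a b d : ℤ) ^ 2 := by
  refine sum_sq_le_sum_sq_of_balanced _ _ (fun d => (cum G ord S0 a b d : ℤ))
    (fun d => (cum G ord S0 (a + 1) (b + 1) d : ℤ)) (card_inArcs G v) ?_ ?_
  · exact_mod_cast sum_inArcs_cum_eq_sum_outArcs_cum G ord S0 a b v
  · intro d hd d' hd'
    simp only [outArcs, Finset.mem_filter, Finset.mem_univ, true_and] at hd hd'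
    exact_mod_cast cum_le_cum_add_one_of_fst_eq G ord S0 (hd.trans hd'.symm) _ _

theorem sum_sq_sub_one_le_two_mul_pot_sub (i t : ℕ) (P : Finset V) (p q : V → G.Dart)
    (hp : ∀ v ∈ P, (p v).snd = v) (hq : ∀ v ∈ P, (q v).snd = v) :
    ∑ v ∈ P, (((cum G ord S0 t (t + i) (p v) : ℤ) - cum G ord S0 t (t + i) (q v)) ^ 2 - 1) ≤
      2 * ((pot G ord S0 i t : ℤ) - pot G ord S0 i (t + 1)) := by
  rw [pot_sub_pot_eq, Finset.mul_sum]
  refine (Finset.sum_le_sum fun v hv => ?_).trans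
    (Finset.sum_le_sum_of_subset_of_nonneg (Finset.subset_univ P) fun v _ _ => ?_)
  · refine sq_sub_one_le_two_mul_sum_sq_sub _ _ (fun d => (cum G ord S0 t (t + i) d : ℤ))
      (fun d => (cum G ord S0 (t + 1) (t + i + 1) d : ℤ)) (card_inArcs G v) ?_ ?_ ?_ ?_
    · exact_mod_cast sum_inArcs_cum_eq_sum_outArcs_cum G ord S0 t (t + i) v
    · intro d hd d' hd'
      simp only [outArcs, Finset.mem_filter, Finset.mem_univ, true_and] at hd hd'
      exact_mod_cast cum_le_cum_add_one_of_fst_eq G ord S0 (hd.trans hd'.symm) _ _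
    · simpa [inArcs] using hp v hv
    · simpa [inArcs] using hq v hv
  · have := sum_outArcs_sq_le_sum_inArcs_sq G ord S0 t (t + i) v
    linarith

theorem pot_antitone (i : ℕ) : Antitone (pot G ord S0 i) := by
  refine antitone_nat_of_succ_le fun t => ?_
  by_cases h : Nonempty G.Dart
  · have := sum_sq_sub_one_le_two_mul_pot_sub G ord S0 i t ∅ (fun _ => h.some) (fun _ => h.some)
      (by simp) (by simp)
    simp at this
    omega
  · rw [not_nonempty_iff] at h
    simp [pot]

theorem cum_le_cum_add_one_of_snd_eq {i t : ℕ} (h : pot G ord S0 i (t + 1) = pot G ord S0 i t)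
    {d d' : G.Dart} (hd : d.snd = d'.snd) :
    cum G ord S0 t (t + i) d ≤ cum G ord S0 t (t + i) d' + 1 := by
  have := sum_sq_sub_one_le_two_mul_pot_sub G ord S0 i t {d.snd} (fun _ => d) (fun _ => d')
    (by simp) (by simp [hd])
  rw [h, Finset.sum_singleton] at this
  by_contra! hlt
  zify at hlt
  nlinarith

theorem exists_perm_of_balanced (a n : ℕ)
    (hB : ∀ b c, a ≤ b → b ≤ c → c ≤ a + n → ∀ d d' : G.Dart, d.snd = d'.snd →
      cum G ord S0 b c d ≤ cum G ord S0 b c d' + 1) :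
    ∃ M : Equiv.Perm G.Dart, (∀ d, (M d).fst = d.snd) ∧
      ∀ d t, a ≤ t → t < a + n → load G ord S0 t d = load G ord S0 (t + 1) (M d) := by
  have hloc : ∀ v : V, ∃ σ : {d : G.Dart // d.snd = v} ≃ {d : G.Dart // d.fst = v},
      ∀ d : {d : G.Dart // d.snd = v}, ∀ t < n,
        load G ord S0 (t + a) d = load G ord S0 (t + (a + 1)) (σ d) := by
    intro v
    refine exists_equiv_of_balanced ?_
      (fun (d : {d : G.Dart // d.snd = v}) t => load G ord S0 (t + a) d)
      (fun (d : {d : G.Dart // d.fst = v}) t => load G ord S0 (t + (a + 1)) d) n ?_ ?_ ?_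
    · rw [Fintype.card_subtype, Fintype.card_subtype]
      exact card_inArcs G v
    · intro d d' b c hbc hc
      rw [Finset.sum_Ico_add' (fun t => load G ord S0 t d),
        Finset.sum_Ico_add' (fun t => load G ord S0 t d')]
      exact hB _ _ (by omega) (by omega) (by omega) d d' (d.2.trans d'.2.symm)
    · intro d d' b c _ _
      rw [Finset.sum_Ico_add' (fun t => load G ord S0 t d),
        Finset.sum_Ico_add' (fun t => load G ord S0 t d')]
      exact cum_le_cum_add_one_of_fst_eq G ord S0 (d.2.trans d'.2.symm) _ _
    · intro t _
      have := sum_inArcs_load_eq_sum_outArcs_load G ord S0 (t + a) v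
      rw [inArcs, outArcs, ← Finset.sum_subtype_eq_sum_filter,
        ← Finset.sum_subtype_eq_sum_filter, Finset.subtype_univ, Finset.subtype_univ] at this
      exact this
  choose σ hσ using hloc
  refine ⟨(Equiv.sigmaFiberEquiv fun d : G.Dart => d.snd).symm.trans
    ((Equiv.sigmaCongrRight σ).trans (Equiv.sigmaFiberEquiv fun d : G.Dart => d.fst)), ?_, ?_⟩
  · intro d
    exact (σ d.snd ⟨d, rfl⟩).2
  · intro d t hat htn
    obtain ⟨t, rfl⟩ := Nat.exists_eq_add_of_le' hat
    exact hσ d.snd ⟨d, rfl⟩ t (by omega)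

section Periodicity

variable {G ord S0} {M : Equiv.Perm G.Dart} {T s : ℕ}

theorem load_add_iterate
    (hM : ∀ d t, T ≤ t → t < s → load G ord S0 t d = load G ord S0 (t + 1) (M d))
    (c t : ℕ) (ht : T ≤ t) (hts : t + c ≤ s) (d : G.Dart) :
    load G ord S0 t d = load G ord S0 (t + c) ((M ^ c) d) := by
  induction c with
  | zero => simp
  | succ c ih =>
    rw [ih (by omega), hM _ _ (by omega) (by omega), pow_succ', Equiv.Perm.mul_apply, add_assoc]

theorem load_add_period
    (hM : ∀ d t, T ≤ t → t < s → load G ord S0 t d = load G ord S0 (t + 1) (M d))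
    {c t : ℕ} (ht : T ≤ t) (hts : t + c ≤ s) {d : G.Dart} (hc : (M ^ c) d = d) :
    load G ord S0 (t + c) d = load G ord S0 t d := by
  conv_lhs => rw [← hc]
  exact (load_add_iterate hM c t ht hts d).symm

omit [DecidableEq V] in
theorem exists_pow_apply_eq
    (M : Equiv.Perm G.Dart) (d : G.Dart) :
    ∃ c, 0 < c ∧ c ≤ Fintype.card G.Dart ∧ (M ^ c) d = d := by
  refine ⟨Function.minimalPeriod M d, ?_, ?_, ?_⟩
  · exact Function.minimalPeriod_pos_of_mem_periodicPts
      (Function.mem_periodicPts.2 ⟨orderOf M, orderOf_pos M, by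
        rw [Function.IsPeriodicPt, Function.IsFixedPt, Equiv.Perm.iterate_eq_pow,
          pow_orderOf_eq_one, Equiv.Perm.one_apply]⟩)
  · exact Function.minimalPeriod_le_card
  · have := Function.iterate_minimalPeriod (f := M) (x := d)
    rwa [Equiv.Perm.iterate_eq_pow] at this

end Periodicity

/-- Local balance of all windows of length at most `4 * m + 1` over a long enough time interval
forces a single arc permutation to transport the loads forever. -/
theorem exists_perm_forall_load_eq (T : ℕ)
    (hB : ∀ i ≤ 2 * Fintype.card G.Dart + 1, ∀ t, T ≤ t →
      t < T + (Fintype.card G.Dart + 1) ^ 2 + 1 → ∀ d d' : G.Dart, d.snd = d'.snd →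
        cum G ord S0 t (t + i) d ≤ cum G ord S0 t (t + i) d' + 1) :
    ∃ M : Equiv.Perm G.Dart,
      ∀ d t, T ≤ t → load G ord S0 t d = load G ord S0 (t + 1) (M d) := by
  set N := Fintype.card G.Dart with hN
  set K := 2 * N + 1 with hK
  obtain ⟨M, -, hM⟩ := exists_perm_of_balanced G ord S0 T K (by
    intro b c hb hbc hc d d' hd
    obtain ⟨i, rfl⟩ := Nat.exists_eq_add_of_le hbc
    exact hB i (by omega) b hb (by nlinarith) d d' hd)
  have main : ∀ s, T + K ≤ s →
      (∀ d t, T ≤ t → t < s → load G ord S0 t d = load G ord S0 (t + 1) (M d)) ∧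
      (∀ a b, T ≤ a → a ≤ b → b ≤ s → b ≤ a + K → ∀ d d' : G.Dart, d.snd = d'.snd →
        cum G ord S0 a b d ≤ cum G ord S0 a b d' + 1) := by
    intro s hs
    induction s, hs using Nat.le_induction with
    | base =>
      refine ⟨hM, ?_⟩
      intro a b ha hab hbs hbK d d' hd
      obtain ⟨i, rfl⟩ := Nat.exists_eq_add_of_le hab
      exact hB i (by omega) a ha (by nlinarith) d d' hd
    | succ s hs ih =>
      obtain ⟨hV, hBal⟩ := ih
      have hBal' : ∀ a b, T ≤ a → a ≤ b → b ≤ s + 1 → b ≤ a + K → ∀ d d' : G.Dart,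
          d.snd = d'.snd → cum G ord S0 a b d ≤ cum G ord S0 a b d' + 1 := by
        intro a b ha hab hbs hbK d d' hd
        by_cases hsmall : a < T + (N + 1) ^ 2 + 1
        · obtain ⟨i, rfl⟩ := Nat.exists_eq_add_of_le hab
          exact hB i (by omega) a ha hsmall d d' hd
        · obtain ⟨c, hc0, hcN, hc⟩ := exists_pow_apply_eq M d
          obtain ⟨c', hc0', hcN', hc'⟩ := exists_pow_apply_eq M d'
          have hl : c * c' ≤ N * N := Nat.mul_le_mul hcN hcN'
          have hl0 : 0 < c * c' := Nat.mul_pos hc0 hc0'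
          have hshift : ∀ e : G.Dart, (M ^ (c * c')) e = e →
              cum G ord S0 a b e = cum G ord S0 (a - c * c') (b - c * c') e := by
            intro e he
            have h1 : c * c' ≤ a := by nlinarith
            have h2 : c * c' ≤ b := h1.trans hab
            obtain ⟨a, rfl⟩ := Nat.exists_eq_add_of_le' h1
            obtain ⟨b, rfl⟩ := Nat.exists_eq_add_of_le' h2
            simp only [cum, Nat.add_sub_cancel]
            rw [← Finset.sum_Ico_add' (fun t => load G ord S0 t e)]
            refine Finset.sum_congr rfl fun t ht => ?_
            rw [Finset.mem_Ico] at ht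
            refine load_add_period hV ?_ ?_ he
            · nlinarith
            · omega
          have hfix : (M ^ (c * c')) d = d := by
            rw [pow_mul]
            exact Function.IsFixedPt.perm_pow hc c'
          have hfix' : (M ^ (c * c')) d' = d' := by
            rw [mul_comm, pow_mul]
            exact Function.IsFixedPt.perm_pow hc' c
          rw [hshift d hfix, hshift d' hfix']
          refine hBal _ _ ?_ ?_ ?_ ?_ d d' hd
          · rw [Nat.le_sub_iff_add_le (by nlinarith)]
            nlinarith
          all_goals omega
      refine ⟨fun d t ht hts => ?_, hBal'⟩
      rcases (Nat.lt_succ_iff_lt_or_eq.1 hts) with hlt | rfl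
      · exact hV d t ht hlt
      obtain ⟨M', -, hM'⟩ := exists_perm_of_balanced G ord S0 (t + 1 - K) K
        (fun b c hb hbc hc => hBal' b c (by omega) hbc (by omega) (by omega))
      obtain ⟨e, he⟩ := M'.surjective (M d)
      have hagree : ∀ u, t + 1 - K ≤ u → u < t → load G ord S0 u d = load G ord S0 u e := by
        intro u hu hut
        rw [hM' e u hu (by omega), hV d u (by omega) hut, he]
      obtain ⟨c, hc0, hcN, hc⟩ := exists_pow_apply_eq M d
      obtain ⟨c', hc0', hcN', hc'⟩ := exists_pow_apply_eq M e
      have hfine : load G ord S0 t d = load G ord S0 t e := by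
        obtain ⟨u, rfl⟩ : ∃ u, t = u + c + c' := ⟨t - c - c', by omega⟩
        have h1 := load_add_period hV (t := u + c') (by omega) (by omega) hc
        have h2 := load_add_period hV (t := u) (by omega) (by omega) hc
        have h3 := load_add_period hV (t := u + c) (by omega) (by omega) hc'
        have h4 := load_add_period hV (t := u) (by omega) (by omega) hc'
        have h5 := hagree u (by omega) (by omega)
        have h6 := hagree (u + c) (by omega) (by omega)
        have h7 := hagree (u + c') (by omega) (by omega)
        rw [show u + c' + c = u + c + c' by omega] at h1
        rw [h1, h7, h4, h3, ← h6, h2, h5]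
      rw [hfine, hM' e t (by omega) (by omega), he]
  exact ⟨M, fun d t ht => (main (T + K + t + 1) (by omega)).1 d t ht (by omega)⟩

theorem isStable_of_perm (h : ∀ v, 0 < G.degree v) (T : ℕ) (M : Equiv.Perm G.Dart)
    (hM : ∀ d t, T ≤ t → load G ord S0 t d = load G ord S0 (t + 1) (M d)) :
    IsStable G ord S0 T := by
  set n := orderOf M with hn
  have hload : ∀ t, T ≤ t → ∀ d, load G ord S0 (t + n) d = load G ord S0 t d := by
    intro t ht d
    refine load_add_period (s := t + n) (fun d u hu _ => hM d u hu) ht le_rfl ?_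
    rw [pow_orderOf_eq_one, Equiv.Perm.one_apply]
  have htok : ∀ t, T ≤ t → ∀ v,
      (evol G ord S0 (t + n)).tokens v = (evol G ord S0 t).tokens v := by
    intro t ht v
    rw [← sum_outArcs_load G ord S0 _ (h v), ← sum_outArcs_load G ord S0 _ (h v)]
    exact Finset.sum_congr rfl fun d _ => hload t ht d
  have htok' : ∀ j t, T ≤ t → ∀ v,
      (evol G ord S0 (t + n * j)).tokens v = (evol G ord S0 t).tokens v := by
    intro j
    induction j with
    | zero => simp
    | succ j ih =>
      intro t ht v
      rw [Nat.mul_succ, ← add_assoc, htok _ (by omega), ih t ht]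
  have hcumV : ∀ j v, cumV G ord S0 T (T + n * j) v = j * cumV G ord S0 T (T + n) v := by
    intro j v
    induction j with
    | zero => simp [cumV]
    | succ j ih =>
      have hshift : ∑ t ∈ Ico (T + n * j) (T + n * (j + 1)), (evol G ord S0 t).tokens v =
          cumV G ord S0 T (T + n) v := by
        rw [show T + n * (j + 1) = T + n + n * j by ring, ← Finset.sum_Ico_add']
        exact Finset.sum_congr rfl fun t ht => htok' j t (Finset.mem_Ico.1 ht).1 v
      rw [add_one_mul, ← ih, ← hshift]
      exact (Finset.sum_Ico_consecutive _ (by omega)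
        (by gcongr; omega)).symm
  set J := ∏ v, G.degree v with hJ
  have hJ0 : 0 < J := Finset.prod_pos fun v _ => h v
  refine ⟨T + n * J, ?_, ?_⟩
  · exact Nat.lt_add_of_pos_right (Nat.mul_pos (orderOf_pos M) hJ0)
  · have hptr : (evol G ord S0 (T + n * J)).ptr = (evol G ord S0 T).ptr := by
      funext v
      obtain ⟨c, hc⟩ : G.degree v ∣ J := Finset.dvd_prod_of_mem _ (Finset.mem_univ v)
      rw [ptr_evol G ord S0 (h v) (Nat.le_add_right T (n * J)), hcumV, hc, mul_assoc,
        Nat.add_mul_mod_self_left, Nat.mod_eq_of_lt ((evol G ord S0 T).ptr_lt v (h v))]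
    have htokens : (evol G ord S0 (T + n * J)).tokens = (evol G ord S0 T).tokens :=
      funext fun v => htok' J T le_rfl v
    revert hptr htokens
    generalize evol G ord S0 (T + n * J) = A
    generalize evol G ord S0 T = B
    obtain ⟨pa, ta, _⟩ := A
    obtain ⟨pb, tb, _⟩ := B
    rintro rfl rfl
    rfl

/-! ### The bipartite double cover -/

section DoubleCover

omit [Fintype V] [DecidableEq V] [DecidableRel G.Adj]

/-- The bipartite double cover of a graph. -/
def doubleCover : SimpleGraph (V × Bool) where
  Adj p q := G.Adj p.1 q.1 ∧ p.2 ≠ q.2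
  symm := ⟨fun _ _ h => ⟨h.1.symm, h.2.symm⟩⟩
  loopless := ⟨fun _ h => h.2 rfl⟩

variable {G}

/-- The head (`true`) or the tail (`false`) of a dart. -/
def dartEnd (d : G.Dart) (b : Bool) : V := bif b then d.snd else d.fst

theorem exists_doubleCover_walk {u v : V} (w : G.Walk u v) :
    ∀ a b : Bool, (b = a ↔ Even w.length) →
      ∃ w' : (doubleCover G).Walk (u, a) (v, b), w'.length = w.length := by
  induction w with
  | nil =>
    intro a b hab
    obtain rfl : b = a := hab.2 (by simp)
    exact ⟨.nil, rfl⟩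
  | cons huv p ih =>
    intro a b hab
    obtain ⟨w', hw'⟩ := ih (!a) b (by
      rw [SimpleGraph.Walk.length_cons, Nat.even_add_one] at hab
      rw [← not_iff_not, ← hab]
      cases a <;> cases b <;> simp)
    exact ⟨.cons (show (doubleCover G).Adj _ _ from ⟨huv, by simp⟩) w', by simp [hw']⟩

theorem exists_adj_dist_mod_two_eq (h : ¬ G.Colorable 2) (u : V) :
    ∃ x y, G.Adj x y ∧ G.dist u x % 2 = G.dist u y % 2 := by
  by_contra! hne
  refine h ⟨SimpleGraph.Coloring.mk
    (fun v => (⟨G.dist u v % 2, Nat.mod_lt _ two_pos⟩ : Fin 2)) fun {x y} hxy heq => ?_⟩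
  exact hne x y hxy (Fin.mk.inj_iff.1 heq)

theorem exists_doubleCover_path [Finite V] (hconn : G.Connected) (h : ¬ G.Colorable 2)
    (p q : V × Bool) :
    ∃ w : (doubleCover G).Walk p q, w.IsPath ∧ w.length ≤ 3 * G.diam + 1 := by
  classical
  obtain ⟨u, a⟩ := p
  obtain ⟨v, b⟩ := q
  have : Nonempty V := ⟨u⟩
  have hdiam : ∀ x y, G.dist x y ≤ G.diam := fun x y =>
    SimpleGraph.dist_le_diam (SimpleGraph.connected_iff_ediam_ne_top.1 hconn)
  suffices ∃ w : G.Walk u v, w.length ≤ 3 * G.diam + 1 ∧ (b = a ↔ Even w.length) by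
    obtain ⟨w, hw, hpar⟩ := this
    obtain ⟨w', hw'⟩ := exists_doubleCover_walk w a b hpar
    exact ⟨w'.bypass, w'.bypass_isPath,
      w'.length_bypass_le_length.trans (hw'.le.trans hw)⟩
  obtain ⟨w₀, hw₀⟩ := hconn.exists_walk_length_eq_dist u v
  have h₀ := hdiam u v
  by_cases hpar : b = a ↔ Even w₀.length
  · exact ⟨w₀, by omega, hpar⟩
  · obtain ⟨x, y, hxy, hdist⟩ := exists_adj_dist_mod_two_eq h u
    obtain ⟨w₁, hw₁⟩ := hconn.exists_walk_length_eq_dist u x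
    obtain ⟨w₂, hw₂⟩ := hconn.exists_walk_length_eq_dist u y
    have h₁ := hdiam u x
    have h₂ := hdiam u y
    refine ⟨w₁.append (.cons hxy (w₂.reverse.append w₀)), ?_, ?_⟩
    · simp only [SimpleGraph.Walk.length_append, SimpleGraph.Walk.length_cons,
        SimpleGraph.Walk.length_reverse]
      omega
    · rw [← not_iff_not] at hpar
      simp only [SimpleGraph.Walk.length_append, SimpleGraph.Walk.length_cons,
        SimpleGraph.Walk.length_reverse]
      rw [Nat.even_iff] at hpar ⊢
      have : (w₁.length + (w₂.length + w₀.length + 1)) % 2 = 0 ↔ ¬ w₀.length % 2 = 0 := by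
        omega
      rw [this]
      tauto

theorem sub_le_sum_support (x : G.Dart → ℤ) (r : V × Bool → ℤ)
    (hr : ∀ d d' : G.Dart, ∀ b, dartEnd d b = dartEnd d' b → x d - x d' ≤ r (dartEnd d b, b))
    {p q : V × Bool} (w : (doubleCover G).Walk p q) :
    ∀ d d' : G.Dart, dartEnd d p.2 = p.1 → dartEnd d' q.2 = q.1 →
      x d - x d' ≤ (w.support.map r).sum := by
  induction w with
  | @nil p =>
    intro d d' hd hd'
    have := hr d d' p.2 (hd.trans hd'.symm)
    rw [hd] at this
    simpa using this
  | @cons p c q hpc w ih =>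
    intro d d' hd hd'
    obtain ⟨e, he, he'⟩ : ∃ e : G.Dart, dartEnd e p.2 = p.1 ∧ dartEnd e c.2 = c.1 := by
      obtain ⟨hadj, hne⟩ := hpc
      obtain ⟨p, a⟩ := p
      obtain ⟨c, b⟩ := c
      cases a <;> cases b
      · exact absurd rfl hne
      · exact ⟨⟨(p, c), hadj⟩, rfl, rfl⟩
      · exact ⟨⟨(c, p), hadj.symm⟩, rfl, rfl⟩
      · exact absurd rfl hne
    have h1 := hr d e p.2 (hd.trans he.symm)
    have h2 := ih e d' he' hd'
    rw [hd] at h1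
    simp only [SimpleGraph.Walk.support_cons, List.map_cons, List.sum_cons]
    linarith

theorem exists_sub_le_sum [Finite V] (hconn : G.Connected) (h : ¬ G.Colorable 2)
    (x : G.Dart → ℤ) (r : V → ℤ)
    (hout : ∀ d d' : G.Dart, d.fst = d'.fst → x d ≤ x d' + 1)
    (hin : ∀ d d' : G.Dart, d.snd = d'.snd → x d - x d' ≤ r d.snd) (d d' : G.Dart) :
    ∃ P : Finset V, P.card ≤ 3 * G.diam + 2 ∧
      x d - x d' ≤ ∑ v ∈ P, r v + (3 * G.diam + 2 : ℕ) := by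
  classical
  obtain ⟨w, hw, hlen⟩ := exists_doubleCover_path hconn h (d.fst, false) (d'.fst, false)
  set ρ : V × Bool → ℤ := fun p => bif p.2 then r p.1 else 1 with hρ
  have hle := sub_le_sum_support x ρ (by
    rintro e e' (_ | _) hee
    · have := hout e e' hee
      simp only [hρ, cond_false]
      linarith
    · exact hin e e' hee) w d d' rfl rfl
  set S := w.support.toFinset with hS
  have hcard : S.card ≤ 3 * G.diam + 2 := by
    rw [hS, List.toFinset_card_of_nodup hw.support_nodup, SimpleGraph.Walk.length_support]
    omega
  rw [← List.sum_toFinset ρ hw.support_nodup] at hle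
  have hinj : Set.InjOn Prod.fst (S.filter fun p => p.2 = true : Set (V × Bool)) := by
    rintro ⟨u, a⟩ hu ⟨v, b⟩ hv huv
    simp at hu hv huv
    simp [hu, hv, huv]
  refine ⟨(S.filter fun p => p.2 = true).image Prod.fst, ?_, hle.trans ?_⟩
  · exact Finset.card_image_le.trans ((Finset.card_filter_le _ _).trans hcard)
  · rw [Finset.sum_image hinj, ← Finset.sum_filter_add_sum_filter_not S fun p => p.2 = true]
    refine add_le_add (Finset.sum_le_sum fun p hp => ?_) ?_
    · simp [(Finset.mem_filter.1 hp).2]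
    · refine (Finset.sum_le_card_nsmul _ _ 1 fun p hp => ?_).trans ?_
      · have := (Finset.mem_filter.1 hp).2
        simp only [Bool.not_eq_true] at this
        simp [this]
      · have := (Finset.card_filter_le S fun p => ¬ p.2 = true).trans hcard
        simpa using (by exact_mod_cast this :
          (((S.filter fun p => ¬ p.2 = true).card : ℕ) : ℤ) ≤ (3 * G.diam + 2 : ℕ))

end DoubleCover

/-! ### Decay of the potentials -/

section Decay

variable {G}

theorem sq_sub_le_mul_pot_sub (hconn : G.Connected) (hcol : ¬ G.Colorable 2)
    (hdeg : ∀ v, 0 < G.degree v) (i t : ℕ) (d d' : G.Dart)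
    (h : 4 * ((3 * G.diam + 2 : ℕ) : ℤ) ≤
      (cum G ord S0 t (t + i) d : ℤ) - cum G ord S0 t (t + i) d') :
    ((cum G ord S0 t (t + i) d : ℤ) - cum G ord S0 t (t + i) d') ^ 2 ≤
      4 * ((3 * G.diam + 2 : ℕ) : ℤ) *
        ((pot G ord S0 i t : ℤ) - pot G ord S0 i (t + 1)) := by
  set x : G.Dart → ℤ := fun d => cum G ord S0 t (t + i) d with hx
  have hmax : ∀ v, ∃ p q : G.Dart, p.snd = v ∧ q.snd = v ∧
      ∀ e e' : G.Dart, e.snd = v → e'.snd = v → x e - x e' ≤ x p - x q := by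
    intro v
    have hne : (inArcs G v ×ˢ inArcs G v).Nonempty := by
      rw [Finset.nonempty_product, and_self, ← Finset.card_pos, card_inArcs, card_outArcs]
      exact hdeg v
    obtain ⟨⟨p, q⟩, hpq, hm⟩ := Finset.exists_max_image _ (fun e => x e.1 - x e.2) hne
    simp only [inArcs, Finset.mem_product, Finset.mem_filter, Finset.mem_univ, true_and,
      Prod.forall] at hpq hm
    exact ⟨p, q, hpq.1, hpq.2, fun e e' he he' => hm e e' ⟨he, he'⟩⟩
  choose p q hp hq hpq using hmax
  obtain ⟨P, hPcard, hP⟩ := exists_sub_le_sum hconn hcol x (fun v => x (p v) - x (q v))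
    (fun e e' he => by
      simp only [hx]
      exact_mod_cast cum_le_cum_add_one_of_fst_eq G ord S0 he t (t + i))
    (fun e e' he => hpq _ e e' rfl he.symm) d d'
  have hdrop := sum_sq_sub_one_le_two_mul_pot_sub G ord S0 i t P p q (fun v _ => hp v)
    (fun v _ => hq v)
  change 4 * _ ≤ x d - x d' at h
  change (x d - x d') ^ 2 ≤ _
  change ∑ v ∈ P, ((x (p v) - x (q v)) ^ 2 - 1) ≤ _ at hdrop
  have hcs := sq_sum_le_card_mul_sum_sq (s := P) (f := fun v => x (p v) - x (q v))
  rw [Finset.sum_sub_distrib, Finset.sum_const, nsmul_eq_mul, mul_one] at hdrop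
  have hPcard' : (P.card : ℤ) ≤ ((3 * G.diam + 2 : ℕ) : ℤ) := by exact_mod_cast hPcard
  have hL : (0 : ℤ) < ((3 * G.diam + 2 : ℕ) : ℤ) := by positivity
  have hQ : 0 ≤ ∑ v ∈ P, (x (p v) - x (q v)) ^ 2 := Finset.sum_nonneg fun v _ => sq_nonneg _
  generalize ((3 * G.diam + 2 : ℕ) : ℤ) = L at *
  generalize (pot G ord S0 i t : ℤ) - pot G ord S0 i (t + 1) = Δ at *
  generalize ∑ v ∈ P, (x (p v) - x (q v)) ^ 2 = Q at *
  generalize ∑ v ∈ P, (x (p v) - x (q v)) = R at *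
  generalize x d - x d' = δ at *
  have h1 : R ^ 2 ≤ L * Q := hcs.trans (mul_le_mul_of_nonneg_right hPcard' hQ)
  have h2 : L * Q ≤ L * (2 * Δ + L) := mul_le_mul_of_nonneg_left (by linarith) hL.le
  have h3 : (δ - L) ^ 2 ≤ R ^ 2 := pow_le_pow_left₀ (by linarith) (by linarith) 2
  nlinarith

/-- The excess of the `i`-th potential over its minimum conceivable value, multiplied by `2 * m`. -/
def excess (i t : ℕ) : ℤ :=
  Fintype.card G.Dart * pot G ord S0 i t - (i * ∑ v, S0.tokens v : ℕ) ^ 2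

theorem two_mul_excess (hdeg : ∀ v, 0 < G.degree v) (i t : ℕ) :
    2 * excess ord S0 i t = ∑ d, ∑ d',
      ((cum G ord S0 t (t + i) d : ℤ) - cum G ord S0 t (t + i) d') ^ 2 := by
  have h := sum_cum G ord S0 hdeg i t
  simp only [sub_sq, Finset.sum_add_distrib, Finset.sum_sub_distrib, Finset.sum_const,
    ← Finset.mul_sum, ← Finset.sum_mul, Finset.card_univ, nsmul_eq_mul, excess, pot, ← h]
  push_cast
  ring

theorem excess_nonneg (hdeg : ∀ v, 0 < G.degree v) (i t : ℕ) : 0 ≤ excess ord S0 i t := by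
  have h := two_mul_excess ord S0 hdeg i t
  have : 0 ≤ 2 * excess ord S0 i t := by rw [h]; positivity
  linarith

theorem excess_sub_excess (i t s : ℕ) : excess ord S0 i t - excess ord S0 i s =
    Fintype.card G.Dart * ((pot G ord S0 i t : ℤ) - pot G ord S0 i s) := by
  simp only [excess]
  ring

theorem excess_antitone (i : ℕ) : Antitone (excess ord S0 i) := by
  intro t s hts
  have := pot_antitone G ord S0 i hts
  simp only [excess]
  gcongr

theorem excess_le_or_decay (hconn : G.Connected) (hcol : ¬ G.Colorable 2)
    (hdeg : ∀ v, 0 < G.degree v) (i t : ℕ) :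
    excess ord S0 i t ≤ 8 * (Fintype.card G.Dart : ℤ) ^ 2 * ((3 * G.diam + 2 : ℕ) : ℤ) ^ 2 ∨
      excess ord S0 i t ≤ 2 * Fintype.card G.Dart * ((3 * G.diam + 2 : ℕ) : ℤ) *
        (excess ord S0 i t - excess ord S0 i (t + 1)) := by
  have hexc := two_mul_excess ord S0 hdeg i t
  rcases isEmpty_or_nonempty G.Dart with he | hne
  · left
    simp only [Finset.univ_eq_empty, Finset.sum_empty] at hexc
    have : excess ord S0 i t = 0 := by linarith
    rw [this]
    positivity
  obtain ⟨⟨p, q⟩, -, hmax⟩ := Finset.exists_max_image (univ : Finset (G.Dart × G.Dart))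
    (fun e => (cum G ord S0 t (t + i) e.1 : ℤ) - cum G ord S0 t (t + i) e.2) univ_nonempty
  set R := (cum G ord S0 t (t + i) p : ℤ) - cum G ord S0 t (t + i) q with hR
  have hbound : 2 * excess ord S0 i t ≤ (Fintype.card G.Dart : ℤ) ^ 2 * R ^ 2 := by
    rw [hexc]
    refine (Finset.sum_le_sum fun d _ => Finset.sum_le_sum fun d' _ => ?_).trans
      (b := ∑ _d : G.Dart, ∑ _d' : G.Dart, R ^ 2) ?_
    · have h1 := hmax (d, d') (Finset.mem_univ _)
      have h2 := hmax (d', d) (Finset.mem_univ _)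
      exact sq_le_sq' (by simp only at h2; linarith) h1
    · simp only [Finset.sum_const, Finset.card_univ, nsmul_eq_mul]
      rw [← mul_assoc, ← sq]
  have hR0 : 0 ≤ R := by simpa using hmax (p, p) (Finset.mem_univ _)
  rcases le_or_gt (4 * ((3 * G.diam + 2 : ℕ) : ℤ)) R with hbig | hsmall
  · right
    have h1 := sq_sub_le_mul_pot_sub ord S0 hconn hcol hdeg i t p q hbig
    rw [excess_sub_excess]
    have h2 := mul_le_mul_of_nonneg_left h1 (sq_nonneg (Fintype.card G.Dart : ℤ))
    linarith
  · left
    have h1 : R ^ 2 ≤ (4 * ((3 * G.diam + 2 : ℕ) : ℤ)) ^ 2 := pow_le_pow_left₀ hR0 hsmall.le 2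
    have h2 := mul_le_mul_of_nonneg_left h1 (sq_nonneg (Fintype.card G.Dart : ℤ))
    linarith

end Decay

theorem le_of_decay {E : ℕ → ℝ} {B c A : ℝ} (hE : Antitone E) (hc : 1 ≤ c)
    (hB : 1 ≤ B) (hA : 1 ≤ A) (h0 : E 0 ≤ A)
    (h : ∀ t, E t ≤ B ∨ E t ≤ c * (E t - E (t + 1))) {t : ℕ} (ht : c * Real.log A ≤ t) :
    E t ≤ B := by
  have hc0 : 0 < c := by linarith
  have hc1 : 0 ≤ 1 - 1 / c := by
    rw [sub_nonneg, div_le_one hc0]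
    exact hc
  have key : ∀ s, E s ≤ B ∨ E s ≤ (1 - 1 / c) ^ s * A := by
    intro s
    induction s with
    | zero => simpa using Or.inr h0
    | succ s ih =>
      rcases ih with ih | ih
      · exact Or.inl ((hE (Nat.le_succ s)).trans ih)
      · rcases h s with hs | hs
        · exact Or.inl ((hE (Nat.le_succ s)).trans hs)
        · right
          have : E (s + 1) ≤ (1 - 1 / c) * E s := by
            have : E s / c ≤ E s - E (s + 1) := by
              rw [div_le_iff₀ hc0]
              linarith
            rw [sub_mul, one_mul, one_div_mul_eq_div]
            linarith
          calc E (s + 1) ≤ (1 - 1 / c) * E s := this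
            _ ≤ (1 - 1 / c) * ((1 - 1 / c) ^ s * A) := mul_le_mul_of_nonneg_left ih hc1
            _ = (1 - 1 / c) ^ (s + 1) * A := by ring
  rcases key t with hk | hk
  · exact hk
  · refine hk.trans (le_trans ?_ hB)
    have h1 : (1 - 1 / c) ^ t ≤ Real.exp (-(t / c)) := by
      have := pow_le_pow_left₀ hc1 (Real.one_sub_le_exp_neg (1 / c)) t
      rwa [← Real.exp_nat_mul, show (t : ℝ) * -(1 / c) = -(t / c) by ring] at this
    calc (1 - 1 / c) ^ t * A ≤ Real.exp (-(t / c)) * Real.exp (Real.log A) := by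
          rw [Real.exp_log (by linarith)]
          exact mul_le_mul_of_nonneg_right h1 (by linarith)
      _ = Real.exp (Real.log A - t / c) := by rw [← Real.exp_add]; ring_nf
      _ ≤ 1 := by
          rw [Real.exp_le_one_iff, sub_nonpos, le_div_iff₀ hc0]
          linarith

theorem exists_const_window {F : ℕ → ℕ} (hF : Antitone F) (t₀ Q W : ℕ)
    (hQ : ∀ t, t₀ ≤ t → F t₀ ≤ F t + Q) :
    ∃ j ≤ Q, F (t₀ + j * W + W) = F (t₀ + j * W) := by
  by_contra! hne
  have key : ∀ j ≤ Q + 1, F (t₀ + j * W) + j ≤ F t₀ := by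
    intro j
    induction j with
    | zero => simp
    | succ j ih =>
      intro hj
      have h1 := ih (by omega)
      have h2 := lt_of_le_of_ne (hF (Nat.le_add_right (t₀ + j * W) W)) (hne j (by omega))
      rw [show t₀ + (j + 1) * W = t₀ + j * W + W by ring]
      omega
  have h1 := key (Q + 1) le_rfl
  have h2 := hQ (t₀ + (Q + 1) * W) (Nat.le_add_right _ _)
  omega

theorem pot_eq_of_sum_pot_eq {K a b : ℕ} (hab : a ≤ b)
    (h : ∑ i ∈ range (K + 1), pot G ord S0 i b = ∑ i ∈ range (K + 1), pot G ord S0 i a)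
    {i : ℕ} (hi : i ≤ K) {t : ℕ} (hat : a ≤ t) (htb : t < b) :
    pot G ord S0 i (t + 1) = pot G ord S0 i t := by
  have h1 := (Finset.sum_eq_sum_iff_of_le fun i _ => pot_antitone G ord S0 i hab).1 h i
    (Finset.mem_range.2 (by omega))
  have h2 := pot_antitone G ord S0 i hat
  have h3 := pot_antitone G ord S0 i (Nat.succ_le_of_lt htb)
  have h4 := pot_antitone G ord S0 i (Nat.le_succ t)
  simp only [Nat.succ_eq_add_one] at h3 h4
  omega

/-- If all the potentials of index at most `4 * m + 1` are nearly minimal at time `t₀`, then a stable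
state is reached after boundedly many further steps. -/
theorem exists_isStable_of_excess_le (hdeg : ∀ v, 0 < G.degree v) (t₀ B : ℕ)
    (hB : ∀ i ≤ 2 * Fintype.card G.Dart + 1,
      excess ord S0 i t₀ ≤ (Fintype.card G.Dart : ℤ) * B) (hN : 0 < Fintype.card G.Dart) :
    ∃ T ≤ t₀ + (2 * Fintype.card G.Dart + 2) * B * ((Fintype.card G.Dart + 1) ^ 2 + 1),
      IsStable G ord S0 T := by
  set N := Fintype.card G.Dart
  obtain ⟨j, hj, hconst⟩ := exists_const_window
    (F := fun t => ∑ i ∈ range (2 * N + 1 + 1), pot G ord S0 i t)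
    (fun a b hab => Finset.sum_le_sum fun i _ => pot_antitone G ord S0 i hab)
    t₀ ((2 * N + 2) * B) ((N + 1) ^ 2 + 1) (by
      intro t _
      have hpt : ∀ i ∈ range (2 * N + 1 + 1), pot G ord S0 i t₀ ≤ pot G ord S0 i t + B := by
        intro i hi
        have h1 := hB i (by simp at hi; omega)
        have h2 := excess_nonneg ord S0 hdeg i t
        have h3 := excess_sub_excess ord S0 i t₀ t
        have h4 : (N : ℤ) * ((pot G ord S0 i t₀ : ℤ) - pot G ord S0 i t) ≤ N * B := by
          linarith
        have h5 := le_of_mul_le_mul_left h4 (by exact_mod_cast hN)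
        omega
      refine (Finset.sum_le_sum hpt).trans ?_
      rw [Finset.sum_add_distrib]
      simp)
  set T := t₀ + j * ((N + 1) ^ 2 + 1)
  obtain ⟨M, hM⟩ := exists_perm_forall_load_eq G ord S0 T (by
    intro i hi t hTt ht d d' hd
    exact cum_le_cum_add_one_of_snd_eq G ord S0
      (pot_eq_of_sum_pot_eq G ord S0 (Nat.le_add_right T ((N + 1) ^ 2 + 1)) hconst hi hTt
        (by omega)) hd)
  exact ⟨T, Nat.add_le_add_left (Nat.mul_le_mul_right _ hj) _,
    isStable_of_perm G ord S0 hdeg T M hM⟩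

theorem excess_le_of_le (hdeg : ∀ v, 0 < G.degree v) {m i : ℕ}
    (hm : Fintype.card G.Dart = 2 * m) (hi : i ≤ 5 * m) (hm1 : 1 ≤ m)
    (hk : 1 ≤ ∑ v, S0.tokens v) :
    (excess ord S0 i 0 : ℝ) ≤ (3 * ((∑ v, S0.tokens v : ℕ) : ℝ) * m) ^ 4 := by
  have hpot : pot G ord S0 i 0 ≤ (i * ∑ v, S0.tokens v) ^ 2 := by
    rw [← sum_cum G ord S0 hdeg i 0, sq, Finset.sum_mul]
    refine Finset.sum_le_sum fun d _ => ?_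
    rw [sq]
    exact Nat.mul_le_mul_left _ (Finset.single_le_sum (fun d _ => Nat.zero_le _)
      (Finset.mem_univ d))
  set k := ∑ v, S0.tokens v
  have h1 : (excess ord S0 i 0 : ℤ) ≤ ((2 * m * (5 * m * k) ^ 2 : ℕ) : ℤ) := by
    have h2 : pot G ord S0 i 0 ≤ (5 * m * k) ^ 2 :=
      hpot.trans (Nat.pow_le_pow_left (Nat.mul_le_mul_right _ hi) 2)
    have h3 : Fintype.card G.Dart * pot G ord S0 i 0 ≤ 2 * m * (5 * m * k) ^ 2 := by
      rw [hm]
      exact Nat.mul_le_mul_left _ h2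
    have h4 : excess ord S0 i 0 ≤ ((Fintype.card G.Dart * pot G ord S0 i 0 : ℕ) : ℤ) := by
      rw [excess]
      push_cast
      linarith [sq_nonneg ((i : ℤ) * ∑ v, (S0.tokens v : ℤ))]
    exact h4.trans (by exact_mod_cast h3)
  have h2 : 2 * m * (5 * m * k) ^ 2 ≤ (3 * k * m) ^ 4 := by
    have h3 : m ^ 3 * k ^ 2 ≤ m ^ 4 * k ^ 4 :=
      Nat.mul_le_mul (Nat.pow_le_pow_right hm1 (by norm_num))
        (Nat.pow_le_pow_right hk (by norm_num))
    nlinarith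
  exact_mod_cast h1.trans (by exact_mod_cast h2)

theorem exists_isStable_le (hconn : G.Connected) (hcol : ¬ G.Colorable 2)
    (hk : 1 ≤ ∑ v, S0.tokens v) :
    ∃ T : ℕ, (T : ℝ) ≤ 30000 * ((G.edgeFinset.card : ℝ) ^ 4 * (G.diam : ℝ) ^ 2 +
      (G.edgeFinset.card : ℝ) * (G.diam : ℝ) *
        Real.log (3 * ((∑ v, S0.tokens v : ℕ) : ℝ) * (G.edgeFinset.card : ℝ))) ∧
      IsStable G ord S0 T := by
  have : Nonempty V := hconn.nonempty
  obtain ⟨x, y, hxy, -⟩ := exists_adj_dist_mod_two_eq hcol (Classical.arbitrary V)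
  have : Nontrivial V := ⟨x, y, hxy.ne⟩
  have hdeg : ∀ v, 0 < G.degree v := fun v => hconn.preconnected.degree_pos_of_nontrivial v
  have hD1 : 1 ≤ G.diam := by
    rw [← SimpleGraph.dist_eq_one_iff_adj.2 hxy]
    exact SimpleGraph.dist_le_diam (SimpleGraph.connected_iff_ediam_ne_top.1 hconn)
  have hm1 : 1 ≤ G.edgeFinset.card :=
    Finset.card_pos.2 ⟨s(x, y), SimpleGraph.mem_edgeFinset.2 hxy⟩
  have hN : Fintype.card G.Dart = 2 * G.edgeFinset.card := G.dart_card_eq_twice_card_edges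
  have hE := fun i (hi : i ≤ 5 * G.edgeFinset.card) =>
    excess_le_of_le G ord S0 hdeg hN hi hm1 hk
  set m := G.edgeFinset.card
  set k := ∑ v, S0.tokens v
  set D := G.diam
  set L := 3 * D + 2 with hL
  have hm1' : (1 : ℝ) ≤ m := by exact_mod_cast hm1
  have hk1' : (1 : ℝ) ≤ k := by exact_mod_cast hk
  have hD1' : (1 : ℝ) ≤ D := by exact_mod_cast hD1
  have hL1 : (1 : ℝ) ≤ L := by exact_mod_cast (by omega : 1 ≤ L)
  have hL5 : (L : ℝ) ≤ 5 * D := by exact_mod_cast (by omega : L ≤ 5 * D)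
  have hkm : (1 : ℝ) ≤ 3 * k * m := by nlinarith
  set lg := Real.log (3 * (k : ℝ) * m) with hlg
  have hlg0 : 0 ≤ lg := Real.log_nonneg hkm
  set t₀ := ⌈2 * (2 * m : ℝ) * L * (4 * lg)⌉₊ with ht₀
  have ht₀le : (t₀ : ℝ) ≤ 80 * (m * D * lg) + 1 := by
    have h1 := (Nat.ceil_lt_add_one (a := 2 * (2 * m : ℝ) * L * (4 * lg)) (by positivity)).le
    have h2 : (16 * m * lg : ℝ) * L ≤ (16 * m * lg : ℝ) * (5 * D) :=
      mul_le_mul_of_nonneg_left hL5 (by positivity)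
    linarith
  obtain ⟨T, hT, hst⟩ := exists_isStable_of_excess_le G ord S0 hdeg t₀
      (8 * Fintype.card G.Dart * L ^ 2) (by
    intro i hi
    have hdecay := le_of_decay (E := fun t => (excess ord S0 i t : ℝ))
      (B := 8 * (2 * m : ℝ) ^ 2 * L ^ 2) (c := 2 * (2 * m : ℝ) * L)
      (A := (3 * (k : ℝ) * m) ^ 4) (t := t₀)
      (fun a b hab => Int.cast_le.2 (excess_antitone ord S0 i hab))
      (by nlinarith) (by nlinarith [one_le_pow₀ (n := 2) hm1', one_le_pow₀ (n := 2) hL1])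
      (one_le_pow₀ hkm) (hE i (by omega))
      (fun t => by
        have := excess_le_or_decay ord S0 hconn hcol hdeg i t
        rw [hN] at this
        exact_mod_cast this)
      (by
        rw [Real.log_pow]
        push_cast
        exact Nat.le_ceil _)
    have h2 : excess ord S0 i t₀ ≤ 8 * (2 * m : ℤ) ^ 2 * L ^ 2 := by exact_mod_cast hdecay
    refine h2.trans_eq ?_
    rw [hN]
    push_cast
    ring) (by omega)
  refine ⟨T, ?_, hst⟩
  rw [hN] at hT
  have hT' : (T : ℝ) ≤ t₀ + (2 * (2 * m) + 2) * (8 * (2 * m) * L ^ 2) * ((2 * m + 1) ^ 2 + 1) := by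
    exact_mod_cast hT
  have h1 : (2 * (2 * m) + 2 : ℝ) ≤ 6 * m := by linarith
  have h2 : ((2 * m + 1) ^ 2 + 1 : ℝ) ≤ 10 * m ^ 2 := by nlinarith
  have h3 : (8 * (2 * m) * L ^ 2 : ℝ) ≤ 8 * (2 * m) * (5 * D) ^ 2 := by gcongr
  have h4 : (2 * (2 * m) + 2 : ℝ) * (8 * (2 * m) * L ^ 2) * ((2 * m + 1) ^ 2 + 1) ≤
      6 * m * (8 * (2 * m) * (5 * D) ^ 2) * (10 * m ^ 2) := by gcongr
  have h5 : (1 : ℝ) ≤ m ^ 4 * D ^ 2 :=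
    one_le_mul_of_one_le_of_one_le (one_le_pow₀ hm1') (one_le_pow₀ hD1')
  have h6 : (0 : ℝ) ≤ m * D * lg := by positivity
  linarith

/-- There is a constant `C > 0` such that every rotor-router system on
a finite connected non-bipartite graph with `m` edges and diameter `D`, carrying `k ≥ 1`
tokens, reaches a stable state within `C·(m⁴·D² + m·D·log(3km))` steps. -/
theorem stabilization_time_m4D2 :
    ∃ C : ℝ, 0 < C ∧
      ∀ (sys : System) (S0 : State sys.G),
        ¬ sys.G.Colorable 2 →
        1 ≤ ∑ v : sys.V, S0.tokens v →
        ∃ T : ℕ,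
          (T : ℝ) ≤ C * ((sys.G.edgeFinset.card : ℝ) ^ 4 * (sys.G.diam : ℝ) ^ 2 +
            (sys.G.edgeFinset.card : ℝ) * (sys.G.diam : ℝ) *
              Real.log (3 * ((∑ v : sys.V, S0.tokens v : ℕ) : ℝ) *
                (sys.G.edgeFinset.card : ℝ))) ∧
          IsStable sys.G sys.ord S0 T := by
  exact ⟨30000, by norm_num, fun sys S0 hcol hk =>
    exists_isStable_le sys.G sys.ord S0 sys.conn hcol hk⟩

end RotorRouter
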